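/- For every finite sequence m_0, m_1, …, m_r of elements of ℳ_n, the product β_n^{m_0} · β_n^{m_1} ⋯ β_n^{m_r} lies in the K-linear span of the set ℬ_n. -/

import Mathlib

/-- `uElt T i j` is the element `u_i^j`: the product `T_i T_{i-1} ⋯ T_{i-j+1}`
(interpreted as `1` when `j = 0`). -/
def uElt {A : Type*} [Monoid A] (T : ℕ → A) (i j : ℕ) : A :=
  ((List.range j).map fun t => T (i - t)).prod

/-- `betaElt T n l` is the element `β_n^l = u_1^{l_1} u_2^{l_2} ⋯ u_n^{l_n}`, where the
tuple `(l_1, …, l_n)` is encoded as `l : Fin n → ℕ` (so `l i` is `l_{i+1}`). -/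
def betaElt {A : Type*} [Monoid A] (T : ℕ → A) (n : ℕ) (l : Fin n → ℕ) : A :=
  (List.ofFn fun i : Fin n => uElt T (i.1 + 1) (l i)).prod

/-- The set `ℬ_n = {β_n^l : l ∈ ℒ_n}`, where `ℒ_n` is the set of tuples `(l_1, …, l_n)`
with `0 ≤ l_j ≤ j` for each `j`. -/
def heckeBasisSet {A : Type*} [Monoid A] (T : ℕ → A) (n : ℕ) : Set A :=
  {a : A | ∃ l : Fin n → ℕ, (∀ i : Fin n, l i ≤ i.1 + 1) ∧ a = betaElt T n l}

theorem uElt_succ' {A : Type*} [Monoid A] (T : ℕ → A) (i j : ℕ) :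
    uElt T i (j + 1) = uElt T i j * T (i - j) := by
  simp [uElt, List.range_succ]

theorem betaElt_succ' {A : Type*} [Monoid A] (T : ℕ → A) (m : ℕ) (l : Fin (m + 1) → ℕ) :
    betaElt T (m + 1) l
      = betaElt T m (fun i => l i.castSucc) * uElt T (m + 1) (l (Fin.last m)) := by
  rw [betaElt, List.ofFn_succ', List.concat_eq_append, List.prod_append]
  simp [betaElt]

/-- `u_i^j` commutes with `T_k` for `k` far below its indices. -/
theorem uElt_comm_low {A : Type*} [Monoid A] (n : ℕ) (T : ℕ → A)
    (hc : ∀ j k, 1 ≤ k → k + 2 ≤ j → j ≤ n → T j * T k = T k * T j)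
    (i k : ℕ) (hi : i ≤ n) (hk : 1 ≤ k) :
    ∀ j, k + j ≤ i → (j = 0 ∨ k + j + 1 ≤ i) → uElt T i j * T k = T k * uElt T i j := by
  intro j
  induction j with
  | zero => intro _ _; simp [uElt]
  | succ j ih =>
    intro h1 h2
    rw [uElt_succ', mul_assoc, hc (i - j) k hk (by omega) (by omega), ← mul_assoc,
      ih (by omega) (by omega), mul_assoc]

theorem uElt_shift {A : Type*} [Monoid A] (n : ℕ) (T : ℕ → A)
    (hc : ∀ j k, 1 ≤ k → k + 2 ≤ j → j ≤ n → T j * T k = T k * T j)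
    (hb : ∀ j, 1 ≤ j → j + 1 ≤ n →
      T j * T (j + 1) * T j = T (j + 1) * T j * T (j + 1))
    (i k : ℕ) (hi : i ≤ n) (hk : k + 1 ≤ i) :
    ∀ j, j ≤ i → i < k + j → uElt T i j * T (k + 1) = T k * uElt T i j := by
  intro j
  induction j with
  | zero => intro _ _; omega
  | succ j ih =>
    intro h1 h2
    by_cases h : i < k + j
    · rw [uElt_succ', mul_assoc, ← hc (k + 1) (i - j) (by omega) (by omega) (by omega),
        ← mul_assoc, ih (by omega) h, mul_assoc]
    · obtain ⟨j, rfl⟩ : ∃ j', j = j' + 1 := ⟨j - 1, by omega⟩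
      have e1 : i - (j + 1) = k := by omega
      have e2 : i - j = k + 1 := by omega
      rw [uElt_succ', uElt_succ', e1, e2]
      have := uElt_comm_low n T hc i k hi (by omega) j (by omega) (by omega)
      calc uElt T i j * T (k + 1) * T k * T (k + 1)
          = uElt T i j * (T (k + 1) * T k * T (k + 1)) := by simp only [mul_assoc]
        _ = (uElt T i j * T k) * T (k + 1) * T k := by
            rw [← hb k (by omega) (by omega)]; simp only [mul_assoc]
        _ = _ := by rw [this]; simp only [mul_assoc]

theorem span_mul_uElt {K : Type*} [Field K] {A : Type*} [Ring A] [Algebra K A] (m : ℕ)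
    (T : ℕ → A) (j : ℕ) (hj : j ≤ m + 1) (a : A)
    (ha : a ∈ Submodule.span K (heckeBasisSet T m)) :
    a * uElt T (m + 1) j ∈ Submodule.span K (heckeBasisSet T (m + 1)) := by
  induction ha using Submodule.span_induction with
  | mem x hx =>
    obtain ⟨l, hl, rfl⟩ := hx
    refine Submodule.subset_span ⟨Fin.snoc l j, ?_, ?_⟩
    · intro i
      refine Fin.lastCases ?_ (fun i => ?_) i
      · simpa using hj
      · simpa using hl i
    · rw [betaElt_succ']; simp
  | zero => simp
  | add x y _ _ hx hy => rw [add_mul]; exact add_mem hx hy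
  | smul c x _ hx => rw [smul_mul_assoc]; exact Submodule.smul_mem _ _ hx

theorem span_mul_T {K : Type*} [Field K] (q : K)
    {A : Type*} [Ring A] [Algebra K A] (n : ℕ) (T : ℕ → A)
    (hc : ∀ j k, 1 ≤ k → k + 2 ≤ j → j ≤ n → T j * T k = T k * T j)
    (hb : ∀ j, 1 ≤ j → j + 1 ≤ n →
      T j * T (j + 1) * T j = T (j + 1) * T j * T (j + 1))
    (hq : ∀ j, 1 ≤ j → j ≤ n → T j ^ 2 = (q - 1) • T j + q • (1 : A)) :
    ∀ m, m ≤ n → ∀ k, 1 ≤ k → k ≤ m → ∀ a ∈ Submodule.span K (heckeBasisSet T m),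
      a * T k ∈ Submodule.span K (heckeBasisSet T m) := by
  intro m
  induction m with
  | zero => intro _ k _ _; omega
  | succ m ih =>
    intro hm k hk hkm a ha
    induction ha using Submodule.span_induction with
    | zero => simp
    | add x y _ _ hx hy => rw [add_mul]; exact add_mem hx hy
    | smul c x _ hx => rw [smul_mul_assoc]; exact Submodule.smul_mem _ _ hx
    | mem x hx =>
      obtain ⟨l, hl, rfl⟩ := hx
      rw [betaElt_succ']
      have hb0 : betaElt T m (fun i => l i.castSucc) ∈ Submodule.span K (heckeBasisSet T m) :=
        Submodule.subset_span ⟨_, fun i => by simpa using hl i.castSucc, rfl⟩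
      have hj : l (Fin.last m) ≤ m + 1 := by simpa using hl (Fin.last m)
      generalize betaElt T m (fun i => l i.castSucc) = b at hb0
      generalize l (Fin.last m) = j at hj
      rw [mul_assoc]
      rcases lt_trichotomy (k + j) (m + 1) with h | h | h
      · rw [uElt_comm_low n T hc (m + 1) k hm hk j (by omega) (by omega), ← mul_assoc]
        exact span_mul_uElt m T j hj _ (ih (by omega) k hk (by omega) b hb0)
      · have e : T k = T (m + 1 - j) := by congr 1; omega
        rw [e, ← uElt_succ']
        exact span_mul_uElt m T (j + 1) (by omega) _ hb0
      · by_cases h' : k + j = m + 2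
        · obtain ⟨j, rfl⟩ : ∃ j', j = j' + 1 := ⟨j - 1, by omega⟩
          have e : m + 1 - j = k := by omega
          have e2 : uElt T (m + 1) (j + 1) * T k
              = (q - 1) • uElt T (m + 1) (j + 1) + q • uElt T (m + 1) j := by
            rw [uElt_succ', e, mul_assoc, ← pow_two, hq k hk (by omega), mul_add,
              mul_smul_comm, mul_smul_comm, mul_one]
          rw [e2, mul_add, mul_smul_comm, mul_smul_comm]
          exact add_mem (Submodule.smul_mem _ _ (span_mul_uElt m T _ hj _ hb0))
            (Submodule.smul_mem _ _ (span_mul_uElt m T _ (by omega) _ hb0))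
        · obtain ⟨k, rfl⟩ : ∃ k', k = k' + 1 := ⟨k - 1, by omega⟩
          rw [uElt_shift n T hc hb (m + 1) k hm hkm j hj (by omega), ← mul_assoc]
          exact span_mul_uElt m T j hj _ (ih (by omega) k (by omega) (by omega) b hb0)

theorem prod_betaM_mem_span {K : Type*} [Field K] (q : K)
    {A : Type*} [Ring A] [Algebra K A] (n : ℕ) (T : ℕ → A)
    (hcomm : ∀ j k, 1 ≤ j → j ≤ n → 1 ≤ k → k ≤ n → 2 ≤ |(j : ℤ) - (k : ℤ)| →
      T j * T k = T k * T j)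
    (hbraid : ∀ j, 1 ≤ j → j + 1 ≤ n →
      T j * T (j + 1) * T j = T (j + 1) * T j * T (j + 1))
    (hquad : ∀ j, 1 ≤ j → j ≤ n → T j ^ 2 = (q - 1) • T j + q • (1 : A))
    (r : ℕ) (ms : ℕ → Fin n → ℕ) (hms : ∀ t ≤ r, ∀ i : Fin n, ms t i ≤ 1) :
    ((List.range (r + 1)).map fun t => betaElt T n (ms t)).prod ∈
      Submodule.span K (heckeBasisSet T n) := by

  have hc : ∀ j k, 1 ≤ k → k + 2 ≤ j → j ≤ n → T j * T k = T k * T j := by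
    intro j k h1 h2 h3
    refine hcomm j k (by omega) h3 h1 (by omega) ?_
    exact le_trans (by omega) (le_abs_self _)
  have hT := span_mul_T q n T hc hbraid hquad n le_rfl
  let N : Submonoid A :=
    { carrier := {x | ∀ a ∈ Submodule.span K (heckeBasisSet T n),
        a * x ∈ Submodule.span K (heckeBasisSet T n)}
      one_mem' := fun a ha => by simpa using ha
      mul_mem' := fun {x y} hx hy a ha => by
        rw [← mul_assoc]; exact hy _ (hx a ha) }
  have h1 : (1 : A) ∈ Submodule.span K (heckeBasisSet T n) := by
    refine Submodule.subset_span ⟨fun _ => 0, fun _ => Nat.zero_le _, ?_⟩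
    simp [betaElt, uElt]
  have key : ((List.range (r + 1)).map fun t => betaElt T n (ms t)).prod ∈ N := by
    refine Submonoid.list_prod_mem _ fun x hx => ?_
    obtain ⟨t, ht, rfl⟩ := List.mem_map.1 hx
    have ht' : t ≤ r := by have := List.mem_range.1 ht; omega
    refine Submonoid.list_prod_mem _ fun y hy => ?_
    obtain ⟨i, rfl⟩ := (List.mem_ofFn' _ _).1 hy
    refine Submonoid.list_prod_mem _ fun z hz => ?_
    obtain ⟨s, hs, rfl⟩ := List.mem_map.1 hz
    have hs' := List.mem_range.1 hs
    have := hms t ht' i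
    have := i.2
    exact hT (i.1 + 1 - s) (by omega) (by omega)
  simpa using key 1 h1
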